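/- For every n ≥ 3 there is no finite connected graph Γ such that Υ_sym(sr_n, Γ) = (n+2) · Υ(sr_n, Γ) > n+2. -/

import Mathlib

/-- `X` meets every subgraph of `Γ` isomorphic to `K`. -/
def KCover {W V : Type} (K : SimpleGraph W) (Γ : SimpleGraph V) (X : Set V) : Prop :=
  ∀ f : K →g Γ, Function.Injective f → ∃ w : W, f w ∈ X

/-- `X` is invariant under all automorphisms of `Γ`. -/
def AutInvariant {V : Type} (Γ : SimpleGraph V) (X : Set V) : Prop :=
  ∀ g : Γ ≃g Γ, (fun v => g v) '' X = X

/-- The vertex representativity `Υ(K, Γ)`. -/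
noncomputable def upsilon {W V : Type} (K : SimpleGraph W) (Γ : SimpleGraph V) : ℕ :=
  sInf {m | ∃ X : Set V, X.Finite ∧ Nat.card X = m ∧ KCover K Γ X}

/-- The symmetric vertex representativity `Υ_sym(K, Γ)`. -/
noncomputable def upsilonSym {W V : Type} (K : SimpleGraph W) (Γ : SimpleGraph V) : ℕ :=
  sInf {m | ∃ X : Set V, X.Finite ∧ Nat.card X = m ∧ AutInvariant Γ X ∧ KCover K Γ X}

/-- The `Aut Γ`-orbit of a vertex. -/
def autOrbit {V : Type} (Γ : SimpleGraph V) (v : V) : Set V :=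
  {w | ∃ g : Γ ≃g Γ, g v = w}

/-- The "star with a tail" `sr_d`: the star `K_{1,d}` (centre `0`, leaves `1,…,d`)
with an extra vertex `d+1` joined to the leaf `d`; it has `d+2` vertices. -/
def srGraph (d : ℕ) : SimpleGraph (Fin (d + 2)) :=
  SimpleGraph.fromRel (fun x y =>
    (x.val = 0 ∧ 1 ≤ y.val ∧ y.val ≤ d) ∨ (x.val = d ∧ y.val = d + 1))

open Classical in
/-- combinatorial description of a copy of `sr_n`. -/
def IsCp {V : Type} (Γ : SimpleGraph V) (n : ℕ) (c : V) (S : Finset V) (l t : V) : Prop :=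
  (∀ s ∈ S, Γ.Adj c s) ∧ S.card = n ∧ l ∈ S ∧ t ∉ S ∧ t ≠ c ∧ Γ.Adj l t

/-- vertex set of the copy -/
def cpSet {V : Type} (c : V) (S : Finset V) (t : V) : Set V := {v | v = c ∨ v = t ∨ v ∈ S}

/-- a set meeting every copy exactly once -/
def ExactX {V : Type} (Γ : SimpleGraph V) (n : ℕ) (X : Set V) : Prop :=
  ∀ c S l t, IsCp Γ n c S l t →
    (∃ v ∈ cpSet c S t, v ∈ X) ∧
    ∀ v ∈ cpSet c S t, ∀ w ∈ cpSet c S t, v ∈ X → w ∈ X → v = w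

/-- connectivity closure -/
lemma closed_all {V : Type} {Γ : SimpleGraph V} (hc : Γ.Connected) (P : V → Prop) (a : V)
    (ha : P a) (hcl : ∀ u v, P u → Γ.Adj u v → P v) (v : V) : P v := by
  obtain ⟨w⟩ := hc.preconnected a v
  induction w with
  | nil => exact ha
  | cons h _ ih => exact ih (hcl _ _ ha h)

open Classical in
lemma deg_one {V : Type} {Γ : SimpleGraph V} {n : ℕ} (hn : 3 ≤ n)
    (H1 : ∀ c S l t, IsCp Γ n c S l t → ∀ v ∈ cpSet c S t, ∃ X, v ∈ X ∧ ExactX Γ n X)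
    {c : V} {S : Finset V} {l t u : V} (h : IsCp Γ n c S l t) (hu : Γ.Adj c u) (huS : u ∉ S) :
    u = t := by
  by_contra hut
  have h0 := h
  obtain ⟨hS, hcard, hl, htS, htc, hlt⟩ := h
  have h2 : 1 < (S.erase l).card := by
    rw [Finset.card_erase_of_mem hl]; omega
  obtain ⟨a, ha, b, hb, hab⟩ := Finset.one_lt_card.1 h2
  rw [Finset.mem_erase] at ha hb
  obtain ⟨X, haX, hX⟩ := H1 c S l t h0 a (Or.inr (Or.inr ha.2))
  have key : ∀ s, s ∈ S → s ≠ l → IsCp Γ n c (insert u (S.erase s)) l t := by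
    intro s hs hsl
    refine ⟨?_, ?_, ?_, ?_, htc, hlt⟩
    · intro y hy
      rcases Finset.mem_insert.1 hy with rfl | hy
      · exact hu
      · exact hS _ (Finset.mem_of_mem_erase hy)
    · rw [Finset.card_insert_of_notMem (fun hh => huS (Finset.mem_of_mem_erase hh)),
        Finset.card_erase_of_mem hs]; omega
    · exact Finset.mem_insert_of_mem (Finset.mem_erase.2 ⟨hsl.symm, hl⟩)
    · intro hh
      rcases Finset.mem_insert.1 hh with hh | hh
      · exact hut hh.symm
      · exact htS (Finset.mem_of_mem_erase hh)
  have huX : u ∈ X := by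
    obtain ⟨⟨v, hv, hvX⟩, -⟩ := hX _ _ _ _ (key a ha.2 ha.1)
    have hun := (hX _ _ _ _ h0).2
    rcases hv with hv | hv | hv
    · have := hun v (Or.inl hv) a (Or.inr (Or.inr ha.2)) hvX haX
      exact absurd (hS a ha.2) (by rw [← this, hv]; exact Γ.loopless.irrefl c)
    · have := hun v (Or.inr (Or.inl hv)) a (Or.inr (Or.inr ha.2)) hvX haX
      exact absurd ha.2 (by rw [← this, hv]; exact htS)
    · rcases Finset.mem_insert.1 hv with hv | hv
      · rwa [← hv]
      · have := hun v (Or.inr (Or.inr (Finset.mem_of_mem_erase hv))) a (Or.inr (Or.inr ha.2)) hvX haX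
        exact absurd this (Finset.ne_of_mem_erase hv)
  have := (hX _ _ _ _ (key b hb.2 hb.1)).2 u (Or.inr (Or.inr (Finset.mem_insert_self _ _))) a
    (Or.inr (Or.inr (Finset.mem_insert_of_mem (Finset.mem_erase.2 ⟨hab, ha.2⟩)))) huX haX
  exact huS (this ▸ ha.2)

open Classical in
lemma core {V : Type} [Fintype V] {Γ : SimpleGraph V} {n : ℕ} (hn : 3 ≤ n) (hc : Γ.Connected)
    (H1 : ∀ c S l t, IsCp Γ n c S l t → ∀ v ∈ cpSet c S t, ∃ X, v ∈ X ∧ ExactX Γ n X)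
    (H2 : n + 2 < Fintype.card V)
    (H3 : ∃ c S l t, IsCp Γ n c S l t)
    (H4 : ∀ c S l t, IsCp Γ n c S l t → ∀ v ∈ cpSet c S t, ∃ S' l' t', IsCp Γ n v S' l' t') :
    False := by
  have allc : ∀ v, ∃ S l t, IsCp Γ n v S l t := by
    obtain ⟨c, S, l, t, h⟩ := H3
    refine closed_all hc (fun v => ∃ S l t, IsCp Γ n v S l t) c ⟨S, l, t, h⟩ ?_
    rintro u v ⟨S, l, t, h⟩ huv
    by_cases hv : v ∈ S
    · exact H4 _ _ _ _ h v (Or.inr (Or.inr hv))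
    · exact H4 _ _ _ _ h v (Or.inr (Or.inl (deg_one hn H1 h huv hv)))
  have small : ∀ F : Finset V, F.card ≤ n + 2 → (∀ v, v ∈ F) → False := by
    intro F hF hall
    have : F = Finset.univ := Finset.eq_univ_of_forall hall
    rw [this, Finset.card_univ] at hF
    omega
  have nb : ∀ c, ∃ S : Finset V, S.card = n ∧ (∀ s, s ∈ S ↔ Γ.Adj c s) ∧
      ∃ l t, IsCp Γ n c S l t := by
    intro c
    obtain ⟨S, l, t, h⟩ := allc c
    have h0 := h
    obtain ⟨hS, hcard, hl, htS, htc, hlt⟩ := h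
    by_cases htA : Γ.Adj c t
    · exfalso
      refine small (insert c (insert t S)) ?_ ?_
      · have := Finset.card_insert_le c (insert t S)
        have := Finset.card_insert_le t S
        omega
      · refine closed_all hc (fun v => v ∈ insert c (insert t S)) c (by simp) ?_
        intro y z hy hyz
        by_contra hz
        simp only [Finset.mem_insert, not_or] at hy hz
        obtain ⟨hzc, hzt, hzS⟩ := hz
        have hcz : ¬ Γ.Adj c z := fun hh => hzt (deg_one hn H1 h0 hh hzS)
        have hyc : y ≠ c := by rintro rfl; exact hcz hyz
        have fin : ∀ S' : Finset V, ∀ u, (∀ s ∈ S', Γ.Adj c s) → S'.card = n → y ∈ S' →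
            Γ.Adj c u → u ∉ S' → False := by
          intro S' u h1 h2 h3 h4 h5
          have : IsCp Γ n c S' y z := ⟨h1, h2, h3, fun hh => hcz (h1 _ hh), hzc, hyz⟩
          have := deg_one hn H1 this h4 h5
          exact hcz (this ▸ h4)
        by_cases hyS : y ∈ S
        · exact fin S t hS hcard hyS htA htS
        · have hyt : y = t := by tauto
          refine fin (insert y (S.erase l)) l ?_ ?_ (Finset.mem_insert_self _ _) (hS l hl) ?_
          · intro s hs
            rcases Finset.mem_insert.1 hs with rfl | hs
            · rw [hyt]; exact htA
            · exact hS _ (Finset.mem_of_mem_erase hs)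
          · rw [Finset.card_insert_of_notMem (fun hh => hyS (Finset.mem_of_mem_erase hh)),
              Finset.card_erase_of_mem hl]; omega
          · intro hh
            rcases Finset.mem_insert.1 hh with hh | hh
            · exact hyS (hh ▸ hl)
            · exact (Finset.ne_of_mem_erase hh) rfl
    · refine ⟨S, hcard, fun s => ⟨hS s, fun hs => ?_⟩, l, t, h0⟩
      by_contra hsS
      exact htA (deg_one hn H1 h0 hs hsS ▸ hs)
  choose N hNc hN hNcp using nb
  have cp : ∀ a b l, Γ.Adj a l → Γ.Adj l b → b ≠ a → ¬ Γ.Adj a b → IsCp Γ n a (N a) l b := by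
    intro a b l h1 h2 h3 h4
    exact ⟨fun s hs => (hN a s).1 hs, hNc a, (hN a l).2 h1, fun hh => h4 ((hN a b).1 hh), h3, h2⟩
  have F3 : ∀ a b a' l l', Γ.Adj a l → Γ.Adj l b → b ≠ a → ¬ Γ.Adj a b →
      Γ.Adj b l' → Γ.Adj l' a' → a' ≠ b → ¬ Γ.Adj b a' → a ≠ a' →
      ¬ Γ.Adj a a' ∧ ∀ m, Γ.Adj a m → Γ.Adj m a' → False := by
    intro a b a' l l' h1 h2 h3 h4 k1 k2 k3 k4 haa
    have c1 := cp a b l h1 h2 h3 h4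
    have c2 := cp b a l h2.symm h1.symm h3.symm (fun h => h4 h.symm)
    have c3 := cp b a' l' k1 k2 k3 k4
    obtain ⟨X, haX, hX⟩ := H1 _ _ _ _ c1 a (Or.inl rfl)
    have ha' : a' ∈ X := by
      obtain ⟨⟨v, hv, hvX⟩, -⟩ := hX _ _ _ _ c3
      have un := (hX _ _ _ _ c2).2
      rcases hv with hv | hv | hv
      · have := un v (Or.inl hv) a (Or.inr (Or.inl rfl)) hvX haX
        exact absurd (hv.symm.trans this) h3
      · rwa [← hv]
      · have := un v (Or.inr (Or.inr hv)) a (Or.inr (Or.inl rfl)) hvX haX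
        rw [this] at hv
        exact absurd ((hN b a).1 hv).symm h4
    have hna : ¬ Γ.Adj a a' := by
      intro hh
      exact haa ((hX _ _ _ _ c1).2 a (Or.inl rfl) a' (Or.inr (Or.inr ((hN a a').2 hh))) haX ha')
    refine ⟨hna, fun m m1 m2 => ?_⟩
    have c4 := cp a a' m m1 m2 haa.symm hna
    exact haa ((hX _ _ _ _ c4).2 a (Or.inl rfl) a' (Or.inr (Or.inl rfl)) haX ha')
  obtain ⟨x0⟩ := hc.nonempty
  obtain ⟨x, c, l, hxl, hlc, hcx, hxc⟩ : ∃ x c l, Γ.Adj x l ∧ Γ.Adj l c ∧ c ≠ x ∧ ¬ Γ.Adj x c := by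
    obtain ⟨l, t, h⟩ := hNcp x0
    exact ⟨x0, t, l, (hN _ _).1 h.2.2.1, h.2.2.2.2.2, h.2.2.2.2.1,
      fun hh => h.2.2.2.1 ((hN _ _).2 hh)⟩
  have step : ∀ y z, Γ.Adj x y → Γ.Adj x z → Γ.Adj y c → Γ.Adj y z → Γ.Adj z c := by
    intro y z hy hz hyc hyz
    by_contra hzc
    have hzc' : z ≠ c := by rintro rfl; exact hxc hz
    exact (F3 x c z y y hy hyc hcx hxc hyc.symm hyz hzc' (fun h => hzc h.symm) hz.ne).1 hz
  have NN : ∀ z, Γ.Adj x z → Γ.Adj z c := by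
    intro z hz
    by_cases hzl : z = l
    · rw [hzl]; exact hlc
    by_cases hlz : Γ.Adj l z
    · exact step l z hxl hz hlc hlz
    obtain ⟨w, hwN, hw⟩ : ∃ w ∈ N x, w ∉ ({l, z} : Finset V) := by
      apply Finset.exists_mem_notMem_of_card_lt_card
      have := Finset.card_le_two (a := l) (b := z)
      have := hNc x
      omega
    simp only [Finset.mem_insert, Finset.mem_singleton, not_or] at hw
    have hxw := (hN x w).1 hwN
    have hwl : Γ.Adj l w := by
      by_contra hh
      exact (F3 w l z x x hxw.symm hxl (Ne.symm hw.1) (fun h => hh h.symm) hxl.symm hz hzl hlz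
        hw.2).2 x hxw.symm hz
    have hwz : Γ.Adj w z := by
      by_contra hh
      exact (F3 w z l x x hxw.symm hz (Ne.symm hw.2) hh hz.symm hxl (Ne.symm hzl)
        (fun h => hlz h.symm) hw.1).2 x hxw.symm hxl
    exact step w z hxw hz (step l w hxl hxw hlc hwl) hwz
  have hsub : N x = N c := by
    apply Finset.eq_of_subset_of_card_le
    · intro z hz
      exact (hN c z).2 (NN z ((hN x z).1 hz)).symm
    · rw [hNc, hNc]
  refine small (insert c (insert x (N x))) ?_ ?_
  · have := Finset.card_insert_le c (insert x (N x))
    have := Finset.card_insert_le x (N x)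
    have := hNc x
    omega
  · refine closed_all hc (fun v => v ∈ insert c (insert x (N x))) x (by simp) ?_
    intro y z hy hyz
    by_contra hz
    simp only [Finset.mem_insert, not_or] at hy hz
    obtain ⟨hzc, hzx, hzN⟩ := hz
    rcases hy with rfl | rfl | hy
    · exact hzN (hsub ▸ (hN _ _).2 hyz)
    · exact hzN ((hN _ _).2 hyz)
    · have hxy := (hN _ _).1 hy
      have hyc := NN y hxy
      exact (F3 c x z y y hyc.symm hxy.symm hcx.symm (fun h => hxc h.symm) hxy hyz hzx
        (fun h => hzN ((hN _ _).2 h)) (Ne.symm hzc)).2 y hyc.symm hyz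

open Classical in
lemma cp_of_hom {V : Type} {Γ : SimpleGraph V} {n : ℕ} (hn : 3 ≤ n) (f : srGraph n →g Γ)
    (hf : Function.Injective f) :
    ∃ S l t, IsCp Γ n (f 0) S l t ∧ ∀ w, f w ∈ cpSet (f 0) S t := by
  have hadj : ∀ i j : Fin (n+2), i.val = 0 → 1 ≤ j.val → j.val ≤ n → Γ.Adj (f i) (f j) := by
    intro i j hi h1 h2
    apply f.map_adj
    rw [srGraph, SimpleGraph.fromRel_adj]
    refine ⟨?_, Or.inl (Or.inl ⟨hi, h1, h2⟩)⟩
    rintro rfl; omega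
  let T : Finset (Fin (n+2)) := Finset.univ.image (fun i : Fin n => (⟨i.val + 1, by omega⟩ : Fin (n+2)))
  have hT : ∀ j : Fin (n+2), j ∈ T ↔ 1 ≤ j.val ∧ j.val ≤ n := by
    intro j
    simp only [T, Finset.mem_image, Finset.mem_univ, true_and]
    constructor
    · rintro ⟨i, rfl⟩
      have := i.2
      constructor <;> dsimp only <;> omega
    · rintro ⟨h1, h2⟩
      exact ⟨⟨j.val - 1, by omega⟩, by ext; simp; omega⟩
  have hTc : T.card = n := by
    rw [Finset.card_image_of_injective, Finset.card_univ, Fintype.card_fin]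
    intro i j hij
    ext
    simpa using hij
  refine ⟨T.image f, f ⟨n, by omega⟩, f ⟨n+1, by omega⟩, ⟨?_, ?_, ?_, ?_, ?_, ?_⟩, ?_⟩
  · intro s hs
    obtain ⟨j, hj, rfl⟩ := Finset.mem_image.1 hs
    exact hadj 0 j rfl ((hT j).1 hj).1 ((hT j).1 hj).2
  · rw [Finset.card_image_of_injective _ hf, hTc]
  · exact Finset.mem_image_of_mem _ ((hT _).2 ⟨by simp; omega, by simp⟩)
  · intro hh
    obtain ⟨j, hj, hj2⟩ := Finset.mem_image.1 hh
    have := hf hj2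
    have h2 := ((hT j).1 hj).2
    rw [this] at h2
    simp at h2
  · intro hh
    have := congrArg Fin.val (hf hh)
    simp at this
  · apply f.map_adj
    rw [srGraph, SimpleGraph.fromRel_adj]
    refine ⟨?_, Or.inl (Or.inr ⟨rfl, rfl⟩)⟩
    intro h
    have := congrArg Fin.val h
    simp at this
  · intro w
    by_cases h0 : w.val = 0
    · exact Or.inl (congrArg f (Fin.ext h0))
    by_cases h1 : w.val = n + 1
    · exact Or.inr (Or.inl (congrArg f (Fin.ext h1)))
    · exact Or.inr (Or.inr (Finset.mem_image_of_mem _ ((hT w).2 (by omega))))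

open Classical in
lemma hom_of_cp {V : Type} {Γ : SimpleGraph V} {n : ℕ} (hn : 3 ≤ n) {c : V} {S : Finset V}
    {l t : V} (h : IsCp Γ n c S l t) :
    ∃ f : srGraph n →g Γ, Function.Injective f ∧ f 0 = c ∧ Set.range f = cpSet c S t := by
  obtain ⟨hS, hcard, hl, htS, htc, hlt⟩ := h
  obtain ⟨e, he⟩ : ∃ e : Fin n ≃ S, e ⟨n-1, by omega⟩ = ⟨l, hl⟩ := by
    let e0 : Fin n ≃ S := (S.equivFinOfCardEq hcard).symm
    refine ⟨(Equiv.swap ⟨n-1, by omega⟩ (e0.symm ⟨l, hl⟩)).trans e0, ?_⟩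
    simp
  let F : Fin (n+2) → V := fun i =>
    if h0 : i.val = 0 then c else if h1 : i.val = n + 1 then t else e ⟨i.val - 1, by omega⟩
  have F0 : ∀ i, i.val = 0 → F i = c := fun i hi => dif_pos hi
  have F1 : ∀ i, i.val = n+1 → F i = t := fun i hi => by
    have h0 : i.val ≠ 0 := by omega
    exact (dif_neg h0).trans (dif_pos hi)
  have F2 : ∀ (i : Fin (n+2)) (h0 : i.val ≠ 0) (h1 : i.val ≠ n+1),
      F i = e ⟨i.val - 1, by omega⟩ := fun i h0 h1 =>
    (dif_neg h0).trans (dif_neg h1)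
  have Fl : ∀ i, i.val = n → F i = l := by
    intro i hi
    rw [F2 i (by omega) (by omega)]
    have : (⟨i.val - 1, by omega⟩ : Fin n) = ⟨n-1, by omega⟩ := by ext; simp [hi]
    rw [this, he]
  have FS : ∀ (i : Fin (n+2)) (h0 : i.val ≠ 0) (h1 : i.val ≠ n+1), F i ∈ S := by
    intro i h0 h1
    rw [F2 i h0 h1]
    exact (e _).2
  have hcS : c ∉ S := fun hh => Γ.loopless.irrefl c (hS c hh)
  have rel : ∀ x y : Fin (n+2), ((x.val = 0 ∧ 1 ≤ y.val ∧ y.val ≤ n) ∨ (x.val = n ∧ y.val = n + 1))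
      → Γ.Adj (F x) (F y) := by
    rintro x y (⟨h0, h1, h2⟩ | ⟨h0, h1⟩)
    · rw [F0 x h0]
      exact hS _ (FS y (by omega) (by omega))
    · rw [Fl x h0, F1 y h1]
      exact hlt
  refine ⟨⟨F, ?_⟩, ?_, F0 0 rfl, ?_⟩
  · intro x y hxy
    rw [srGraph, SimpleGraph.fromRel_adj] at hxy
    rcases hxy.2 with h | h
    · exact rel x y h
    · exact (rel y x h).symm
  · intro x y hxy
    change F x = F y at hxy
    by_cases x0 : x.val = 0 <;> by_cases y0 : y.val = 0 <;> by_cases x1 : x.val = n+1 <;>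
      by_cases y1 : y.val = n+1
    all_goals first
      | (apply Fin.ext; omega)
      | (exfalso; omega)
      | skip
    · rw [F0 x x0, F1 y y1] at hxy; exact absurd hxy.symm htc
    · rw [F0 x x0] at hxy; exact absurd (hxy ▸ FS y y0 y1) hcS
    · rw [F0 y y0, F1 x x1] at hxy; exact absurd hxy htc
    · rw [F0 y y0] at hxy; exact absurd (hxy ▸ FS x x0 x1) hcS
    · rw [F1 x x1] at hxy; exact absurd (hxy ▸ FS y y0 y1) htS
    · rw [F1 y y1] at hxy; exact absurd (hxy ▸ FS x x0 x1) htS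
    · rw [F2 x x0 x1, F2 y y0 y1] at hxy
      have := congrArg Fin.val (e.injective (Subtype.ext hxy))
      simp at this
      apply Fin.ext
      omega
  · ext v
    constructor
    · rintro ⟨i, rfl⟩
      change F i ∈ _
      by_cases i0 : i.val = 0
      · exact Or.inl (F0 i i0)
      by_cases i1 : i.val = n+1
      · exact Or.inr (Or.inl (F1 i i1))
      · exact Or.inr (Or.inr (FS i i0 i1))
    · rintro (rfl | rfl | hv)
      · exact ⟨0, F0 0 rfl⟩
      · exact ⟨⟨n+1, by omega⟩, F1 (⟨n+1, by omega⟩ : Fin (n+2)) rfl⟩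
      · refine ⟨⟨(e.symm ⟨v, hv⟩).val + 1, by have := (e.symm ⟨v, hv⟩).2; omega⟩, ?_⟩
        refine (F2 ⟨(e.symm ⟨v, hv⟩).val + 1, by have := (e.symm ⟨v, hv⟩).2; omega⟩ (by simp)
          (by have := (e.symm ⟨v, hv⟩).2; dsimp only; omega)).trans ?_
        simp

open Classical in
/-- The averaging argument. -/
lemma averaging {V : Type} [Fintype V] {Γ : SimpleGraph V} {n : ℕ} (X : Finset V)
    (hX : KCover (srGraph n) Γ X)
    (hmin : ∀ Z : Finset V, AutInvariant Γ Z → KCover (srGraph n) Γ Z → (n+2) * X.card ≤ Z.card) :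
    (∀ f : srGraph n →g Γ, Function.Injective f → ∀ w w', f w ∈ X → f w' ∈ X → w = w') ∧
    ∃ Y : Finset V, (∀ v ∈ Y, ∃ g : Γ ≃g Γ, g v ∈ X) ∧ Y.card = (n+2) * X.card ∧
      ∀ f : srGraph n →g Γ, Function.Injective f → ∀ w, f w ∈ Y := by
  have : Finite (Γ ≃g Γ) := Finite.of_injective (fun g : Γ ≃g Γ => (g : V → V)) DFunLike.coe_injective
  have : Fintype (Γ ≃g Γ) := Fintype.ofFinite _
  set G := Fintype.card (Γ ≃g Γ) with hG
  have hGpos : 0 < G := Fintype.card_pos_iff.2 ⟨SimpleGraph.Iso.refl⟩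
  let p : V → ℕ := fun v => ∑ g : Γ ≃g Γ, if g v ∈ X then 1 else 0
  have psum : ∑ v, p v = G * X.card := by
    simp only [p]
    rw [Finset.sum_comm]
    have : ∀ g : Γ ≃g Γ, (∑ v, if g v ∈ X then 1 else 0) = X.card := by
      intro g
      refine (Equiv.sum_comp g.toEquiv (fun v => if v ∈ X then 1 else 0)).trans ?_
      simp
    rw [Finset.sum_congr rfl (fun g _ => this g)]
    simp [hG]
  have pinv : ∀ (h : Γ ≃g Γ) v, p (h v) = p v := by
    intro h v
    simp only [p]
    refine Fintype.sum_equiv ⟨fun g => h.trans g, fun g => h.symm.trans g, ?_, ?_⟩ _ _ ?_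
    · intro g; ext; simp
    · intro g; ext; simp
    · intro g; simp
  have cnt : ∀ f : srGraph n →g Γ, Function.Injective f → ∀ g : Γ ≃g Γ,
      1 ≤ ∑ w, if g (f w) ∈ X then 1 else 0 := by
    intro f hf g
    obtain ⟨w, hw⟩ := hX (g.toHom.comp f) (g.injective.comp hf)
    have hw' : g (f w) ∈ X := hw
    calc 1 = if g (f w) ∈ X then 1 else 0 := by simp [hw']
      _ ≤ _ := Finset.single_le_sum (f := fun w => if g (f w) ∈ X then 1 else 0)
          (fun _ _ => Nat.zero_le _) (Finset.mem_univ w)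
  have pf : ∀ f : srGraph n →g Γ, ∑ w, p (f w) = ∑ g : Γ ≃g Γ, ∑ w, if g (f w) ∈ X then 1 else 0 := by
    intro f
    simp only [p]
    rw [Finset.sum_comm]
  have pge : ∀ f : srGraph n →g Γ, Function.Injective f → G ≤ ∑ w, p (f w) := by
    intro f hf
    rw [pf]
    calc G = ∑ g : Γ ≃g Γ, 1 := by simp [hG]
      _ ≤ _ := Finset.sum_le_sum (fun g _ => cnt f hf g)
  let Y : Finset V := Finset.univ.filter (fun v => G ≤ (n+2) * p v)
  have hYinv : AutInvariant Γ Y := by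
    intro g
    ext v
    simp only [Set.mem_image, Y, Finset.coe_filter, Finset.mem_univ, true_and, Set.mem_ofPred_eq]
    constructor
    · rintro ⟨u, hu, rfl⟩
      rwa [pinv]
    · intro hv
      refine ⟨g.symm v, ?_, by simp⟩
      rwa [pinv]
  have hYcov : KCover (srGraph n) Γ Y := by
    intro f hf
    by_contra hcon
    push Not at hcon
    have h1 : ∀ w, (n+2) * p (f w) < G := by
      intro w
      have := hcon w
      simpa [Y] using this
    have h2 : ∑ w, (n+2) * p (f w) < ∑ w : Fin (n+2), G :=
      Finset.sum_lt_sum_of_nonempty Finset.univ_nonempty (fun w _ => h1 w)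
    rw [← Finset.mul_sum] at h2
    simp at h2
    have := pge f hf
    omega
  have hYc := hmin Y hYinv hYcov
  let q : V → ℕ := fun v => if v ∈ Y then G else 0
  have hqp : ∀ v, q v ≤ (n+2) * p v := by
    intro v
    simp only [q]
    split_ifs with hv
    · simpa [Y] using hv
    · exact Nat.zero_le _
  have hqs : ∑ v, q v = Y.card * G := by simp [q]
  have hps : ∑ v, (n+2) * p v = (n+2) * X.card * G := by
    rw [← Finset.mul_sum, psum]; ring
  have hle : ∑ v, q v ≤ ∑ v, (n+2) * p v := Finset.sum_le_sum (fun v _ => hqp v)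
  have hge : (n+2) * X.card * G ≤ Y.card * G := Nat.mul_le_mul_right _ hYc
  have heq : ∑ v, q v = ∑ v, (n+2) * p v := by omega
  have hpt : ∀ v, q v = (n+2) * p v := fun v =>
    (Finset.sum_eq_sum_iff_of_le (fun v _ => hqp v)).1 heq v (Finset.mem_univ v)
  have hYcard : Y.card = (n+2) * X.card := by
    rw [hqs, hps] at heq
    exact Nat.eq_of_mul_eq_mul_right hGpos heq
  have hpl : ∀ v, (n+2) * p v ≤ G := by
    intro v
    rw [← hpt]
    simp only [q]
    split_ifs <;> omega
  have hfw : ∀ f : srGraph n →g Γ, Function.Injective f → ∀ w, (n+2) * p (f w) = G := by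
    intro f hf
    have h1 : ∑ w, (n+2) * p (f w) ≤ ∑ w : Fin (n+2), G := Finset.sum_le_sum (fun w _ => hpl _)
    have h2 : ∑ w : Fin (n+2), G ≤ ∑ w, (n+2) * p (f w) := by
      rw [← Finset.mul_sum]
      simp only [Finset.sum_const, Finset.card_univ, Fintype.card_fin, smul_eq_mul]
      exact Nat.mul_le_mul_left _ (pge f hf)
    intro w
    exact (Finset.sum_eq_sum_iff_of_le (fun w _ => hpl (f w))).1 (le_antisymm h1 h2) w
      (Finset.mem_univ w)
  refine ⟨?_, Y, ?_, hYcard, ?_⟩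
  · intro f hf w w' hw hw'
    have h1 : (n+2) * ∑ w, p (f w) = (n+2) * G := by
      rw [Finset.mul_sum, Finset.sum_congr rfl (fun w _ => hfw f hf w)]
      simp
    have h2 : ∑ w, p (f w) = G := Nat.eq_of_mul_eq_mul_left (by omega) h1
    have h3 : ∑ g : Γ ≃g Γ, 1 = ∑ g : Γ ≃g Γ, ∑ w, if g (f w) ∈ X then 1 else 0 := by
      rw [← pf, h2]; simp [hG]
    have h4 := (Finset.sum_eq_sum_iff_of_le (fun g _ => cnt f hf g)).1 h3
      (SimpleGraph.Iso.refl) (Finset.mem_univ _)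
    have h5 : (Finset.univ.filter (fun w => f w ∈ X)).card = 1 := by
      rw [Finset.card_filter]
      exact h4.symm
    exact Finset.card_le_one.1 h5.le w (by simpa using hw) w' (by simpa using hw')
  · intro v hv
    by_contra hcon
    push Not at hcon
    have : p v = 0 := by
      simp only [p]
      exact Finset.sum_eq_zero (fun g _ => by simp [hcon g])
    have h2 : G ≤ (n+2) * p v := by simpa [Y] using hv
    rw [this] at h2
    omega
  · intro f hf w
    have := hfw f hf w
    simp only [Y, Finset.mem_filter, Finset.mem_univ, true_and]
    omega

open Classical in
lemma main_aux (n : ℕ) (hn : 3 ≤ n) {V : Type} [Fintype V] (Γ : SimpleGraph V)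
    (hc : Γ.Connected)
    (h1 : upsilonSym (srGraph n) Γ = (n + 2) * upsilon (srGraph n) Γ)
    (h2 : n + 2 < upsilonSym (srGraph n) Γ) : False := by
  have symle : ∀ Z : Finset V, AutInvariant Γ Z → KCover (srGraph n) Γ Z →
      upsilonSym (srGraph n) Γ ≤ Z.card := by
    intro Z hZ hZ2
    exact Nat.sInf_le ⟨Z, Z.finite_toSet, by simp, hZ, hZ2⟩
  obtain ⟨X0, hX0f, hX0c, hX0⟩ : ∃ X : Set V, X.Finite ∧ Nat.card X = upsilon (srGraph n) Γ ∧
      KCover (srGraph n) Γ X := by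
    have : upsilon (srGraph n) Γ ∈ {m | ∃ X : Set V, X.Finite ∧ Nat.card X = m ∧ KCover (srGraph n) Γ X} :=
      Nat.sInf_mem ⟨_, Set.univ, Set.finite_univ, rfl, fun f _ => ⟨0, trivial⟩⟩
    exact this
  obtain ⟨X, rfl⟩ := hX0f.exists_finset_coe
  have hXc : X.card = upsilon (srGraph n) Γ := by simpa using hX0c
  obtain ⟨E1, Y, hYg, hYc, hYf⟩ := averaging X hX0 (fun Z hZ hZ2 => by
    rw [hXc, ← h1]; exact symle Z hZ hZ2)
  let A : Finset V := Finset.univ.filter (fun v => ∃ f : srGraph n →g Γ, Function.Injective f ∧ f 0 = v)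
  have hA : ∀ v, v ∈ A ↔ ∃ f : srGraph n →g Γ, Function.Injective f ∧ f 0 = v := by
    intro v; simp [A]
  have hAY : A = Y := by
    apply Finset.eq_of_subset_of_card_le
    · intro v hv
      obtain ⟨f, hf, rfl⟩ := (hA v).1 hv
      exact hYf f hf 0
    · rw [hYc, hXc, ← h1]
      apply symle
      · have key : ∀ (g : Γ ≃g Γ) v, v ∈ A → g v ∈ A := by
          intro g v hv
          obtain ⟨f, hf, rfl⟩ := (hA v).1 hv
          exact (hA _).2 ⟨g.toHom.comp f, g.injective.comp hf, rfl⟩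
        intro g
        ext v
        constructor
        · rintro ⟨u, hu, rfl⟩
          exact key g u hu
        · intro hv
          exact ⟨g.symm v, key g.symm v hv, by simp⟩
      · intro f hf
        exact ⟨0, (hA _).2 ⟨f, hf, rfl⟩⟩
  have hcard : n + 2 < Fintype.card V := by
    refine lt_of_lt_of_le h2 (symle Finset.univ ?_ ?_)
    · intro g
      simp [g.surjective.range_eq]
    · intro f _
      exact ⟨0, by simp⟩
  refine core hn hc ?_ hcard ?_ ?_
  · intro c S l t h v hv
    obtain ⟨f, hf, hf0, hfr⟩ := hom_of_cp hn h
    rw [← hfr] at hv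
    obtain ⟨w, rfl⟩ := hv
    obtain ⟨g, hg⟩ := hYg _ (hYf f hf w)
    refine ⟨{u | g u ∈ X}, hg, ?_⟩
    intro c' S' l' t' h'
    obtain ⟨f', hf', hf0', hfr'⟩ := hom_of_cp hn h'
    rw [← hfr']
    constructor
    · obtain ⟨w, hw⟩ := hX0 (g.toHom.comp f') (g.injective.comp hf')
      exact ⟨f' w, ⟨w, rfl⟩, hw⟩
    · rintro _ ⟨w, rfl⟩ _ ⟨w', rfl⟩ hw hw'
      exact congrArg f' (E1 (g.toHom.comp f') (g.injective.comp hf') w w' hw hw')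
  · by_contra hcon
    have : upsilonSym (srGraph n) Γ ≤ (∅ : Finset V).card := by
      apply symle
      · intro g; simp
      · intro f hf
        obtain ⟨S, l, t, h, -⟩ := cp_of_hom hn f hf
        exact absurd ⟨_, S, l, t, h⟩ hcon
    simp at this
    omega
  · intro c S l t h v hv
    obtain ⟨f, hf, hf0, hfr⟩ := hom_of_cp hn h
    rw [← hfr] at hv
    obtain ⟨w, rfl⟩ := hv
    have := hYf f hf w
    rw [← hAY] at this
    obtain ⟨f', hf', he⟩ := (hA _).1 this
    obtain ⟨S', l', t', h', -⟩ := cp_of_hom hn f' hf'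
    rw [he] at h'
    refine ⟨S', l', t', ?_⟩
    assumption

/-- Theorem 2.4: for `n ≥ 3` there is no connected finite graph `Γ` with
`Υ_sym(sr_n, Γ) = (n+2)·Υ(sr_n, Γ) > n+2`. -/
theorem stmt12 (n : ℕ) (hn : 3 ≤ n) :
    ¬ ∃ (V : Type) (_ : Fintype V) (Γ : SimpleGraph V),
        Γ.Connected ∧
        upsilonSym (srGraph n) Γ = (n + 2) * upsilon (srGraph n) Γ ∧
        n + 2 < upsilonSym (srGraph n) Γ := by
  rintro ⟨V, _, Γ, hc, h1, h2⟩
  exact main_aux n hn Γ hc h1 h2
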